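/- Let (Y_i, Y_j) be jointly Gaussian, mean zero, variances σ_i², σ_j² > 0, correlation ρ ∈ (−1,1), ρ' = √(1−ρ²), δ̄ > 0 and δ* = δ̄/(√2σ_i). Then the conditional expectation E[|Y_j| given |Y_i| > δ̄] equals √(2/π)·σ_j·(1/(1−erf(δ*)))·(1 − erf(δ*/ρ') + ρ·erf(ρδ*/ρ')·exp(−δ*²)). -/

import Mathlib

open Real MeasureTheory

/-- The Gauss error function. -/
noncomputable def erf (x : ℝ) : ℝ := (2 / Real.sqrt π) * ∫ t in (0 : ℝ)..x, Real.exp (-t ^ 2)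

open Filter Topology

lemma continuous_exp_neg_sq : Continuous fun t : ℝ => Real.exp (-t ^ 2) := by fun_prop

lemma hasDerivAt_erf (x : ℝ) : HasDerivAt erf (2 / √π * Real.exp (-x ^ 2)) x :=
  (continuous_exp_neg_sq.integral_hasStrictDerivAt 0 x).hasDerivAt.const_mul _

lemma erf_zero : erf 0 = 0 := by simp [erf]

lemma erf_neg (x : ℝ) : erf (-x) = -erf x := by
  have h := intervalIntegral.integral_comp_neg (a := 0) (b := x)
    (fun t : ℝ => Real.exp (-t ^ 2))
  simp only [neg_sq, neg_zero] at h
  rw [erf, erf, intervalIntegral.integral_symm, h]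
  ring

lemma monotone_erf : Monotone erf := by
  refine monotone_of_deriv_nonneg (fun x => (hasDerivAt_erf x).differentiableAt) fun x => ?_
  rw [(hasDerivAt_erf x).deriv]
  positivity

lemma tendsto_erf_atTop : Tendsto erf atTop (𝓝 1) := by
  have hint : Integrable fun t : ℝ => Real.exp (-t ^ 2) := by
    simpa using integrable_exp_neg_mul_sq one_pos
  have h := (intervalIntegral_tendsto_integral_Ioi 0 hint.integrableOn tendsto_id).const_mul
    (2 / √π)
  have hval : ∫ t in Set.Ioi (0 : ℝ), Real.exp (-t ^ 2) = √π / 2 := by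
    simpa using integral_gaussian_Ioi 1
  rw [hval] at h
  have hpi : √π ≠ 0 := by positivity
  rwa [show 2 / √π * (√π / 2) = 1 by field_simp] at h

lemma erf_le_one (x : ℝ) : erf x ≤ 1 := monotone_erf.ge_of_tendsto tendsto_erf_atTop x

lemma abs_erf_le_one (x : ℝ) : |erf x| ≤ 1 :=
  abs_le.2 ⟨by linarith [erf_le_one (-x), erf_neg x], erf_le_one x⟩

lemma mul_erf_nonneg (x : ℝ) : 0 ≤ x * erf x := by
  rcases le_total 0 x with hx | hx
  · exact mul_nonneg hx (erf_zero ▸ monotone_erf hx)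
  · exact mul_nonneg_of_nonpos_of_nonpos hx (erf_zero ▸ monotone_erf hx)

lemma tendsto_exp_neg_sq_atTop : Tendsto (fun t : ℝ => Real.exp (-t ^ 2)) atTop (𝓝 0) :=
  Real.tendsto_exp_atBot.comp (tendsto_neg_atTop_atBot.comp (tendsto_pow_atTop two_ne_zero))

lemma hasDerivAt_exp_neg_sq (x : ℝ) :
    HasDerivAt (fun t : ℝ => Real.exp (-t ^ 2)) (-(2 * x) * Real.exp (-x ^ 2)) x := by
  convert ((hasDerivAt_pow 2 x).fun_neg).exp using 1
  simp
  ring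

lemma integral_Ioi_exp_neg_sq {b : ℝ} (hb : 0 < b) (a : ℝ) :
    ∫ x in Set.Ioi a, Real.exp (-(b * x) ^ 2) = √π / (2 * b) * (1 - erf (b * a)) := by
  have hpi : √π ≠ 0 := by positivity
  have hder : ∀ x ∈ Set.Ici a, HasDerivAt (fun x => √π / (2 * b) * erf (b * x))
      (Real.exp (-(b * x) ^ 2)) x := fun x _ => by
    have h := ((hasDerivAt_erf (b * x)).comp x ((hasDerivAt_id x).const_mul b)).const_mul
      (√π / (2 * b))
    refine h.congr_deriv ?_
    field_simp
  have hlim := (tendsto_erf_atTop.comp (tendsto_id.const_mul_atTop hb)).const_mul (√π / (2 * b))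
  rw [integral_Ioi_of_hasDerivAt_of_nonneg' hder (fun x _ => by positivity) hlim]
  ring

lemma integrableOn_and_integral_Ioi_mul_exp_neg_sq {c : ℝ} (hc : 0 < c) (k : ℝ) :
    IntegrableOn (fun v => v * Real.exp (-(c * v - k) ^ 2)) (Set.Ioi 0) ∧
    ∫ v in Set.Ioi 0, v * Real.exp (-(c * v - k) ^ 2) =
      1 / (2 * c ^ 2) * (Real.exp (-k ^ 2) + √π * k * (1 + erf k)) := by
  have hpi : √π ≠ 0 := by positivity
  have hder : ∀ v ∈ Set.Ici (0 : ℝ), HasDerivAt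
      (fun v => 1 / (2 * c ^ 2) * (√π * k * erf (c * v - k) - Real.exp (-(c * v - k) ^ 2)))
      (v * Real.exp (-(c * v - k) ^ 2)) v := fun v _ => by
    have hlin : HasDerivAt (fun v : ℝ => c * v - k) (c * 1) v :=
      ((hasDerivAt_id v).const_mul c).sub_const k
    have h := ((((hasDerivAt_erf (c * v - k)).comp v hlin).const_mul (√π * k)).sub
      ((hasDerivAt_exp_neg_sq (c * v - k)).comp v hlin)).const_mul (1 / (2 * c ^ 2))
    refine h.congr_deriv ?_
    field_simp
    ring
  have hlin : Tendsto (fun v : ℝ => c * v - k) atTop atTop :=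
    tendsto_atTop_add_const_right _ (-k) (tendsto_id.const_mul_atTop hc)
  have hlim := (((tendsto_erf_atTop.comp hlin).const_mul (√π * k)).sub
    (tendsto_exp_neg_sq_atTop.comp hlin)).const_mul (1 / (2 * c ^ 2))
  have hnonneg : ∀ v ∈ Set.Ioi (0 : ℝ), 0 ≤ v * Real.exp (-(c * v - k) ^ 2) :=
    fun v hv => mul_nonneg (le_of_lt hv) (Real.exp_pos _).le
  refine ⟨integrableOn_Ioi_deriv_of_nonneg' hder hnonneg hlim, ?_⟩
  rw [integral_Ioi_of_hasDerivAt_of_nonneg' hder hnonneg hlim]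
  simp only [mul_zero, zero_sub, erf_neg, neg_sq]
  ring

lemma integral_abs_mul_exp_neg_sq {c : ℝ} (hc : 0 < c) (k : ℝ) :
    ∫ v : ℝ, |v| * Real.exp (-(c * v - k) ^ 2) =
      1 / c ^ 2 * (Real.exp (-k ^ 2) + √π * k * erf k) := by
  obtain ⟨hint, hval⟩ := integrableOn_and_integral_Ioi_mul_exp_neg_sq hc k
  obtain ⟨hint', hval'⟩ := integrableOn_and_integral_Ioi_mul_exp_neg_sq hc (-k)
  have hpos : Set.EqOn (fun v => v * Real.exp (-(c * v - k) ^ 2))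
      (fun v => |v| * Real.exp (-(c * v - k) ^ 2)) (Set.Ioi 0) := fun v hv => by
    simp only [abs_of_pos (Set.mem_Ioi.1 hv)]
  have hneg : Set.EqOn (fun v => v * Real.exp (-(c * v - -k) ^ 2))
      (fun v => |(-v)| * Real.exp (-(c * -v - k) ^ 2)) (Set.Ioi 0) := fun v hv => by
    simp only [abs_neg, abs_of_pos (Set.mem_Ioi.1 hv)]
    ring_nf
  have hIoi := hint.congr_fun hpos measurableSet_Ioi
  have hIio := hint'.congr_fun hneg measurableSet_Ioi
  have hIic : IntegrableOn (fun v => |v| * Real.exp (-(c * v - k) ^ 2)) (Set.Iic 0) := by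
    rw [integrableOn_Iic_iff_integrableOn_Iio,
      ← (Measure.measurePreserving_neg volume).integrableOn_comp_preimage
        (Homeomorph.neg ℝ).measurableEmbedding, Set.neg_preimage, Set.neg_Iio, neg_zero]
    exact hIio
  rw [← intervalIntegral.integral_Iic_add_Ioi hIic hIoi,
    ← setIntegral_congr_fun measurableSet_Ioi hpos, hval]
  have h := integral_comp_neg_Ioi 0 (fun v => |v| * Real.exp (-(c * v - k) ^ 2))
  rw [neg_zero] at h
  rw [← h, ← setIntegral_congr_fun measurableSet_Ioi hneg, hval', erf_neg, neg_sq]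
  field_simp
  ring

lemma integral_Ioi_exp_neg_sq_mul_add_mul_erf {b e : ℝ} (hb : 0 < b) (he : 0 < e) {d : ℝ}
    (hbde : b ^ 2 + d ^ 2 = e ^ 2) {a : ℝ} :
    ∫ x in Set.Ioi a, Real.exp (-(b * x) ^ 2) *
        (Real.exp (-(d * x) ^ 2) + √π * (d * x) * erf (d * x)) =
      √π / (2 * b ^ 2) *
        (e * (1 - erf (e * a)) + d * Real.exp (-(b * a) ^ 2) * erf (d * a)) := by
  have hpi : √π ≠ 0 := by positivity
  have hder : ∀ x ∈ Set.Ici a, HasDerivAt (fun x => √π / (2 * b ^ 2) *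
      (e * erf (e * x) - d * (Real.exp (-(b * x) ^ 2) * erf (d * x))))
      (Real.exp (-(b * x) ^ 2) * (Real.exp (-(d * x) ^ 2) + √π * (d * x) * erf (d * x))) x :=
    fun x _ => by
    have hlin : ∀ r : ℝ, HasDerivAt (fun x : ℝ => r * x) (r * 1) x :=
      fun r => (hasDerivAt_id x).const_mul r
    have hexp : Real.exp (-(e * x) ^ 2) = Real.exp (-(b * x) ^ 2) * Real.exp (-(d * x) ^ 2) := by
      rw [← Real.exp_add, mul_pow e, ← hbde]
      ring_nf
    have h := ((((hasDerivAt_erf (e * x)).comp x (hlin e)).const_mul e).sub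
      ((((hasDerivAt_exp_neg_sq (b * x)).comp x (hlin b)).mul
        ((hasDerivAt_erf (d * x)).comp x (hlin d))).const_mul d)).const_mul
        (√π / (2 * b ^ 2))
    refine h.congr_deriv ?_
    simp only [Function.comp_apply]
    rw [hexp]
    generalize Real.exp (-(d * x) ^ 2) = E
    field_simp
    linear_combination -E * hbde
  have hprod : Tendsto (fun x => Real.exp (-(b * x) ^ 2) * erf (d * x)) atTop (𝓝 0) :=
    (tendsto_exp_neg_sq_atTop.comp (tendsto_id.const_mul_atTop hb)).zero_mul_isBoundedUnder_le
      (isBoundedUnder_of ⟨1, fun x => abs_erf_le_one (d * x)⟩)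
  have hlim := (((tendsto_erf_atTop.comp (tendsto_id.const_mul_atTop he)).const_mul e).sub
    (hprod.const_mul d)).const_mul (√π / (2 * b ^ 2))
  have hnonneg : ∀ x ∈ Set.Ioi a, 0 ≤ Real.exp (-(b * x) ^ 2) *
      (Real.exp (-(d * x) ^ 2) + √π * (d * x) * erf (d * x)) := fun x _ => by
    have := mul_erf_nonneg (d * x)
    rw [mul_assoc √π]
    positivity
  rw [integral_Ioi_of_hasDerivAt_of_nonneg' hder hnonneg hlim]
  ring

lemma integral_ite_lt_abs {a : ℝ} (ha : 0 ≤ a) {f : ℝ → ℝ} (hf : ∀ x, f (-x) = f x) :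
    ∫ x, (if a < |x| then f x else 0) = 2 * ∫ x in Set.Ioi a, f x := by
  have hfabs : ∀ x, f |x| = f x := fun x => by
    rcases abs_choice x with h | h <;> simp [h, hf]
  have h := integral_comp_abs (f := (Set.Ioi a).indicator f)
  rw [setIntegral_indicator measurableSet_Ioi,
    Set.inter_eq_right.2 (Set.Ioi_subset_Ioi ha)] at h
  rw [← h]
  refine integral_congr_ae (.of_forall fun x => ?_)
  simp [Set.indicator_apply, hfabs]

/-- Closed form of the conditional expectation `E[|Y_j| | |Y_i| > δ̄]` for a mean-zero
bivariate normal pair, defined as `E[|Y_j|·1_A]/P(A)` with `A = {|Y_i| > δ̄}` and the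
expectations written as integrals against the joint (resp. marginal) densities. -/
theorem bivariate_conditional_abs_moment (σi σj ρ δbar : ℝ)
    (hσi : 0 < σi) (hσj : 0 < σj) (hρ : ρ ∈ Set.Ioo (-1 : ℝ) 1) (hδ : 0 < δbar)
    (ρ' : ℝ) (hρ' : ρ' = Real.sqrt (1 - ρ ^ 2))
    (δstar : ℝ) (hδstar : δstar = δbar / (Real.sqrt 2 * σi))
    (p : ℝ → ℝ → ℝ)
    (hp : ∀ yj yi, p yj yi = (1 / (2 * π * ρ' * σi * σj)) *
      Real.exp (-(yj ^ 2) / (2 * σj ^ 2) -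
        (yi - ρ * (σi / σj) * yj) ^ 2 / (2 * ρ' ^ 2 * σi ^ 2))) :
    (∫ yi : ℝ, ∫ yj : ℝ, (if δbar < |yi| then |yj| * p yj yi else 0)) /
      (∫ yi : ℝ, (if δbar < |yi| then
        (1 / (σi * Real.sqrt (2 * π))) * Real.exp (-(yi ^ 2) / (2 * σi ^ 2)) else 0)) =
    Real.sqrt (2 / π) * σj * (1 / (1 - erf δstar)) *
      (1 - erf (δstar / ρ') + ρ * erf (ρ * δstar / ρ') * Real.exp (-δstar ^ 2)) := by
  obtain ⟨hρl, hρu⟩ := hρ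
  have hρpos : 0 < 1 - ρ ^ 2 := by nlinarith
  have hr : 0 < ρ' := hρ' ▸ Real.sqrt_pos.2 hρpos
  have hr2 : ρ' ^ 2 = 1 - ρ ^ 2 := by rw [hρ', Real.sq_sqrt hρpos.le]
  have h2 : 0 < √(2 : ℝ) := by positivity
  have h22 : √(2 : ℝ) ^ 2 = 2 := Real.sq_sqrt zero_le_two
  have hpi : 0 < √π := by positivity
  have hpi2 : √π ^ 2 = π := Real.sq_sqrt pi_pos.le
  set b := 1 / (√2 * σi) with hb
  set c := 1 / (√2 * ρ' * σj) with hc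
  set d := ρ / (√2 * ρ' * σi) with hd
  set e := 1 / (√2 * ρ' * σi) with he
  have hb0 : 0 < b := by positivity
  have hc0 : 0 < c := by positivity
  have he0 : 0 < e := by positivity
  have hbde : b ^ 2 + d ^ 2 = e ^ 2 := by
    rw [hb, hd, he]
    field_simp
    linear_combination hr2
  have hden : ∫ yi : ℝ, (if δbar < |yi| then
      (1 / (σi * √(2 * π))) * Real.exp (-(yi ^ 2) / (2 * σi ^ 2)) else 0) = 1 - erf δstar := by
    rw [integral_ite_lt_abs hδ.le (fun x => by rw [neg_sq]), integral_const_mul]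
    have hexp : ∀ x : ℝ, -(x ^ 2) / (2 * σi ^ 2) = -(b * x) ^ 2 := fun x => by
      rw [hb, mul_pow, div_pow, mul_pow, h22]
      ring
    simp only [hexp]
    rw [integral_Ioi_exp_neg_sq hb0, Real.sqrt_mul zero_le_two,
      show b * δbar = δstar by rw [hb, hδstar]; ring, hb]
    field_simp
  have hinner : ∀ yi, ∫ yj : ℝ, (if δbar < |yi| then |yj| * p yj yi else 0) =
      if δbar < |yi| then (1 / (2 * π * ρ' * σi * σj)) * (1 / c ^ 2) *
        (Real.exp (-(b * yi) ^ 2) *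
          (Real.exp (-(d * yi) ^ 2) + √π * (d * yi) * erf (d * yi))) else 0 := fun yi => by
    split_ifs
    · have hp' : ∀ yj, |yj| * p yj yi = (1 / (2 * π * ρ' * σi * σj)) *
          Real.exp (-(b * yi) ^ 2) * (|yj| * Real.exp (-(c * yj - d * yi) ^ 2)) := fun yj => by
        rw [hp, show -(yj ^ 2) / (2 * σj ^ 2) -
          (yi - ρ * (σi / σj) * yj) ^ 2 / (2 * ρ' ^ 2 * σi ^ 2) =
            -(b * yi) ^ 2 + -(c * yj - d * yi) ^ 2 by
          rw [hb, hc, hd]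
          field_simp
          rw [h22]
          linear_combination (2 * (yi ^ 2 * σj ^ 2 - yj ^ 2 * σi ^ 2)) * hr2, Real.exp_add]
        ring
      simp only [hp']
      rw [integral_const_mul, integral_abs_mul_exp_neg_sq hc0]
      ring
    · simp
  rw [hden]
  simp only [hinner]
  rw [integral_ite_lt_abs hδ.le (fun x => by
    simp only [mul_neg, neg_sq, erf_neg, neg_mul, neg_neg]),
    integral_const_mul, integral_Ioi_exp_neg_sq_mul_add_mul_erf hb0 he0 hbde,
    show b * δbar = δstar by rw [hb, hδstar]; ring,
    show d * δbar = ρ * δstar / ρ' by rw [hd, hδstar]; field_simp,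
    show e * δbar = δstar / ρ' by rw [he, hδstar]; field_simp,
    Real.sqrt_div zero_le_two, ← hpi2, Real.sqrt_sq hpi.le, mul_right_comm, mul_one_div]
  rw [div_eq_mul_one_div, mul_one_div _ (1 - erf δstar), mul_one_div]
  rw [hb, hc, hd, he]
  field_simp
  rw [h22]
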